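/- arXiv:1709.04313 — 2 statements merged into one kernel-verified Lean document; each statement's English description precedes it below -/
import Mathlib

section
/- The number of permutations σ ∈ S_α satisfying ξ(στ) + ξ(σ) = α + 1 (where τ is the full cycle) equals the α-th Catalan number Cat_α. -/
/-- Number of disjoint cycles of a permutation, counting fixed points. -/
def cycleCount {n : ℕ} (σ : Equiv.Perm (Fin n)) : ℕ :=
  σ.cycleType.card + (n - σ.support.card)

namespace NCP
open Equiv Equiv.Perm

set_option linter.unusedSectionVars false
variable {X : Type*} [Fintype X] [DecidableEq X]

/-- reflection length -/
def len (p : Perm X) : ℕ := (p.cycleType.map (fun k => k - 1)).sum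

lemma len_one : len (1 : Perm X) = 0 := by simp [len]

lemma len_inv (p : Perm X) : len p⁻¹ = len p := by simp [len]

lemma len_add_card (p : Perm X) : len p + p.cycleType.card = p.support.card := by
  rw [← sum_cycleType]
  have h : ∀ k ∈ p.cycleType, 1 ≤ k := fun k hk => (one_lt_of_mem_cycleType hk).le
  unfold len
  generalize p.cycleType = s at h
  induction s using Multiset.induction_on with
  | empty => simp
  | cons a s ih =>
    have h1 := h a (by simp)
    have h2 := ih (fun k hk => h k (by simp [hk]))
    simp only [Multiset.map_cons, Multiset.sum_cons, Multiset.card_cons]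
    omega

lemma len_mul {p q : Perm X} (h : Perm.Disjoint p q) : len (p * q) = len p + len q := by
  simp [len, h.cycleType_mul]

lemma len_formPerm {l : List X} (h : l.Nodup) : len l.formPerm = l.length - 1 := by
  rcases Nat.lt_or_ge l.length 2 with hl | hl
  · rw [(List.formPerm_eq_one_iff _ h).2 (by omega), len_one]; omega
  · rw [len, (List.isCycle_formPerm h hl).cycleType, List.support_formPerm_of_nodup _ h
      (by rintro x rfl; simp at hl), List.toFinset_card_of_nodup h]
    simp

lemma formPerm_disj {l l' : List X} (h : l.Disjoint l') :
    Perm.Disjoint l.formPerm l'.formPerm := by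
  intro x
  by_cases hx : x ∈ l
  · right; exact List.formPerm_apply_of_notMem (fun h' => h hx h')
  · left; exact List.formPerm_apply_of_notMem hx

lemma swap3 {x y z : X} (h1 : x ≠ y) (h2 : x ≠ z) (h3 : y ≠ z) :
    swap x y * (swap x z * swap z y) = swap x z := by
  ext w
  simp only [Perm.mul_apply, swap_apply_def]
  grind

lemma formPerm_split (x y : X) (l2 : List X) : ∀ (l1 : List X), (x :: (l1 ++ y :: l2)).Nodup →
    swap x y * (x :: (l1 ++ y :: l2)).formPerm = (x :: l1).formPerm * (y :: l2).formPerm := by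
  intro l1
  induction l1 generalizing x with
  | nil => intro _; simp [List.formPerm_cons_cons, ← mul_assoc]
  | cons z l1 ih =>
    intro h
    have h' : (z :: (l1 ++ y :: l2)).Nodup := (List.nodup_cons.1 h).2
    have := ih z h'
    have e : (z :: (l1 ++ y :: l2)).formPerm
        = swap z y * ((z :: l1).formPerm * (y :: l2).formPerm) := by
      rw [← this, ← mul_assoc]; simp
    rw [List.cons_append, List.formPerm_cons_cons, e, List.formPerm_cons_cons]
    have s3 := swap3 (x := x) (y := y) (z := z) (by rintro rfl; simp at h)
      (by rintro rfl; simp at h) (by rintro rfl; simp at h)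
    rw [mul_assoc (swap x z)]
    conv_rhs => rw [← s3]
    simp only [mul_assoc]

lemma len_swap_same {p : Perm X} {x y : X} (hxy : x ≠ y) (h : SameCycle p x y) :
    len (swap x y * p) + 1 = len p := by
  have hx : p x ≠ x := by
    intro hx
    obtain ⟨i, hi⟩ := h
    exact hxy (by rw [← hi, zpow_apply_eq_self_of_apply_eq_self hx])
  have hxs : x ∈ p.support := by simpa using hx
  obtain ⟨l, hL⟩ : ∃ l, p.toList x = x :: l := by
    have hlen := length_toList_pos_of_mem_support p x hxs
    have h0 := toList_getElem_zero p x hxs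
    cases hL : p.toList x with
    | nil => simp [hL] at hlen
    | cons b l => simp [hL] at h0; exact ⟨l, by rw [h0]⟩
  have hy : y ∈ p.toList x := mem_toList_iff.2 ⟨h, hxs⟩
  have hnd := nodup_toList p x
  have hf := formPerm_toList p x
  have hc : p.cycleOf x ∈ p.cycleFactorsFinset := by
    rw [cycleOf_mem_cycleFactorsFinset_iff]; exact hxs
  have hd := disjoint_mul_inv_of_mem_cycleFactorsFinset hc
  have hsup : ∀ z ∈ p.toList x, (p * (p.cycleOf x)⁻¹) z = z := by
    intro z hz
    rcases hd z with h' | h'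
    · exact h'
    · exfalso
      rw [← hf] at h'
      rw [List.formPerm_apply_mem_eq_self_iff _ hnd _ hz] at h'
      have := two_le_length_toList_iff_mem_support.2 hxs
      omega
  generalize hT : p * (p.cycleOf x)⁻¹ = T at hd hsup
  have hp : p = p.cycleOf x * T := by
    rw [← hd.commute.eq, ← hT]; simp
  rw [hL] at hy hnd hf hsup
  have hy' : y ∈ l := by simpa [hxy.symm] using hy
  obtain ⟨l1, l2, rfl⟩ := List.append_of_mem hy'
  have hs := formPerm_split _ y l2 l1 hnd
  rw [hf] at hs
  have hdis : List.Disjoint (x :: l1) (y :: l2) := by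
    rw [← List.cons_append] at hnd
    exact List.disjoint_of_nodup_append hnd
  have hn1 : (x :: l1).Nodup := by
    rw [← List.cons_append] at hnd
    exact hnd.of_append_left
  have hn2 : (y :: l2).Nodup := by
    rw [← List.cons_append] at hnd
    exact hnd.of_append_right
  have e1 : len (swap x y * p) = l1.length + l2.length + len T := by
    have hs2 : swap x y * (p.cycleOf x) = (x :: l1).formPerm * (y :: l2).formPerm := hs
    have hp2 : swap x y * p.cycleOf x * T
      = (x :: l1).formPerm * (y :: l2).formPerm * T := by rw [hs2]
    have : Perm.Disjoint ((x :: l1).formPerm * (y :: l2).formPerm) T := by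
      intro z
      by_cases hz : z ∈ x :: (l1 ++ y :: l2)
      · right; exact hsup z hz
      · left
        have a1 : z ∉ x :: l1 := by simp at hz ⊢; tauto
        have a2 : z ∉ y :: l2 := by simp at hz ⊢; tauto
        rw [Perm.mul_apply, List.formPerm_apply_of_notMem a2, List.formPerm_apply_of_notMem a1]
    have hp3 : swap x y * p = (x :: l1).formPerm * (y :: l2).formPerm * T := by
      rw [← hp2, mul_assoc, ← hp]
    rw [hp3, len_mul this, len_mul (formPerm_disj hdis), len_formPerm hn1, len_formPerm hn2]
    simp
  have e2 : len p = l1.length + l2.length + 1 + len T := by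
    conv_lhs => rw [hp]
    rw [len_mul hd.symm, ← hf, len_formPerm hnd]
    simp; omega
  omega

lemma sameCycle_swap {p : Perm X} {x y : X} (h : ¬ SameCycle p x y) :
    SameCycle (swap x y * p) x y := by
  have hex : ∃ n, 0 < n ∧ (p ^ n) x = x := ⟨orderOf p, orderOf_pos p, by simp [pow_orderOf_eq_one]⟩
  classical
  let n := Nat.find hex
  obtain ⟨hn, hnx⟩ := Nat.find_spec hex
  have hmin : ∀ m, 0 < m → m < n → (p ^ m) x ≠ x := fun m h0 hm he => Nat.find_min hex hm ⟨h0, he⟩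
  have key : ∀ m, m < n → ((swap x y * p) ^ m) x = (p ^ m) x := by
    intro m
    induction m with
    | zero => intro _; simp
    | succ m ih =>
      intro hm
      rw [pow_succ', Perm.mul_apply, ih (by omega), Perm.mul_apply, ← Perm.mul_apply p, ← pow_succ']
      apply swap_apply_of_ne_of_ne
      · exact hmin _ (by omega) hm
      · intro he; exact h ⟨(m + 1 : ℕ), by rw [zpow_natCast]; exact he⟩
  refine ⟨(n : ℕ), ?_⟩
  rw [zpow_natCast]
  obtain ⟨m, hm⟩ : ∃ m, n = m + 1 := ⟨n - 1, by have : 0 < n := hn; omega⟩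
  rw [hm, pow_succ', Perm.mul_apply, key m (by omega), Perm.mul_apply, ← Perm.mul_apply p,
    ← pow_succ', ← hm]
  have : (p ^ n) x = x := hnx
  rw [this, swap_apply_left]

lemma swap_swap_mul (x y : X) (p : Perm X) : swap x y * (swap x y * p) = p := by
  rw [← mul_assoc]; simp

lemma len_swap_not {p : Perm X} {x y : X} (h : ¬ SameCycle p x y) :
    len (swap x y * p) = len p + 1 := by
  have hxy : x ≠ y := by rintro rfl; exact h (SameCycle.refl _ _)
  have := len_swap_same hxy (sameCycle_swap h)
  rw [swap_swap_mul] at this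
  exact this.symm

lemma len_swap_le (p : Perm X) (x y : X) : len (swap x y * p) ≤ len p + 1 := by
  by_cases hxy : x = y
  · subst hxy; simp [← Perm.one_def]
  by_cases h : SameCycle p x y
  · have := len_swap_same hxy h; omega
  · exact (len_swap_not h).le

lemma len_R (p : Perm X) (a : X) (h : p a ≠ a) : len (swap a (p a) * p) + 1 = len p :=
  len_swap_same h.symm ⟨1, by simp⟩

lemma len_tri (q : Perm X) : ∀ (n : ℕ) (p : Perm X), len p = n → len (p * q) ≤ len p + len q := by
  intro n
  induction n with
  | zero =>
    intro p hp
    by_cases h : p = 1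
    · subst h; simp
    · obtain ⟨a, ha⟩ : ∃ a, p a ≠ a := by
        by_contra! hc; exact h (Perm.ext hc)
      have := len_R p a ha; omega
  | succ n ih =>
    intro p hp
    by_cases h : p = 1
    · subst h; simp
    · obtain ⟨a, ha⟩ : ∃ a, p a ≠ a := by
        by_contra! hc; exact h (Perm.ext hc)
      have h1 := len_R p a ha
      have h2 := ih (swap a (p a) * p) (by omega)
      have h3 := len_swap_le (swap a (p a) * p * q) a (p a)
      rw [mul_assoc (swap a (p a)) p q, swap_swap_mul] at h3
      rw [mul_assoc] at h2
      omega

lemma len_eq_zero {p : Perm X} (h : len p = 0) : p = 1 := by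
  by_contra hp
  obtain ⟨a, ha⟩ : ∃ a, p a ≠ a := by
    by_contra! hc; exact hp (Perm.ext hc)
  have := len_R p a ha; omega

/-- interval below t -/
def S (t : Perm X) : Finset (Perm X) := Finset.univ.filter (fun s => len s + len (s⁻¹ * t) = len t)

lemma mem_S {s t : Perm X} : s ∈ S t ↔ len s + len (s⁻¹ * t) = len t := by simp [S]

lemma S_same {s t : Perm X} (h : s ∈ S t) (a : X) : SameCycle t a (s a) := by
  rw [mem_S] at h
  by_cases ha : s a = a
  · rw [ha]
  by_contra hc
  have h1 := len_R s a ha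
  have h2 := len_swap_not hc
  have h3 := len_tri (s⁻¹ * t) _ (swap a (s a) * s) rfl
  rw [mul_assoc, mul_inv_cancel_left] at h3
  omega

lemma S_fib1 {s t : Perm X} {a j : X} (hj : SameCycle t a j) :
    (s ∈ S t ∧ s a = j) ↔ (swap a j * s ∈ S (swap a j * t) ∧ (swap a j * s) a = a) := by
  have e : (swap a j * s) a = a ↔ s a = j := by
    rw [Perm.mul_apply, swap_apply_eq_iff, swap_apply_left]
  rw [e]
  refine and_congr_left fun hs => ?_
  by_cases haj : a = j
  · subst haj; simp [← Perm.one_def]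
  have h1 := len_R s a (by rw [hs]; exact fun h => haj h.symm)
  rw [hs] at h1
  have h2 := len_swap_same haj hj
  rw [mem_S, mem_S]
  have : (swap a j * s)⁻¹ * (swap a j * t) = s⁻¹ * t := by group
  rw [this]; omega

lemma S_fib2 {s t : Perm X} {a : X} : (s ∈ S t ∧ s a = a) ↔ s ∈ S (swap a (t a) * t) := by
  have key : s a = a → (s ∈ S t ↔ s ∈ S (swap a (t a) * t)) := by
    intro hs
    by_cases ht : t a = a
    · rw [ht]; simp [← Perm.one_def]
    have hs' : s⁻¹ a = a := by rw [Perm.inv_eq_iff_eq]; exact hs.symm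
    have h1 := len_R t a ht
    have h2 := len_R (s⁻¹ * t) a (by
      rw [Perm.mul_apply]; intro h; rw [Perm.inv_eq_iff_eq, hs] at h; exact ht h)
    have e : swap a ((s⁻¹ * t) a) * (s⁻¹ * t) = s⁻¹ * (swap a (t a) * t) := by
      rw [← mul_assoc, ← mul_assoc, Perm.mul_apply]
      congr 1
      rw [Equiv.mul_swap_eq_swap_mul, hs']
    rw [e] at h2
    rw [mem_S, mem_S]; omega
  constructor
  · rintro ⟨h1, h2⟩; exact (key h2).1 h1
  · intro h
    have h1 := S_same h a
    have hs : s a = a := by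
      obtain ⟨i, hi⟩ := h1
      rw [← hi]; apply zpow_apply_eq_self_of_apply_eq_self
      simp
    exact ⟨(key hs).2 h, hs⟩

lemma card_fib {t : Perm X} {a j : X} (hj : SameCycle t a j) :
    ((S t).filter (fun s => s a = j)).card
      = (S (swap a ((swap a j * t) a) * (swap a j * t))).card := by
  apply Finset.card_bij (fun s _ => swap a j * s)
  · intro s hs
    rw [Finset.mem_filter, S_fib1 hj, S_fib2] at hs
    exact hs
  · intro s _ s' _ h; exact mul_left_cancel h
  · intro s hs
    refine ⟨swap a j * s, ?_, swap_swap_mul _ _ _⟩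
    rw [Finset.mem_filter, S_fib1 hj, S_fib2, swap_swap_mul]
    exact hs

/-- product of cycles -/
def PP (L : List (List X)) : Perm X := (L.map List.formPerm).prod

lemma PP_cons (l : List X) (L : List (List X)) : PP (l :: L) = l.formPerm * PP L := by simp [PP]

lemma PP_fix {L : List (List X)} {x : X} (h : x ∉ L.flatten) : PP L x = x := by
  induction L with
  | nil => simp [PP]
  | cons l L ih =>
    simp only [List.flatten_cons, List.mem_append, not_or] at h
    rw [PP_cons, Perm.mul_apply, ih h.2, List.formPerm_apply_of_notMem h.1]

lemma PP_R {a : X} {l : List X} {T : Perm X} (h : (a :: l).Nodup) (hT : T a = a) :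
    swap a (((a :: l).formPerm * T) a) * ((a :: l).formPerm * T) = l.formPerm * T := by
  rw [Perm.mul_apply, hT]
  cases l with
  | nil => simp [← Perm.one_def]
  | cons b l =>
    rw [List.formPerm_apply_head _ _ _ h, List.formPerm_cons_cons, mul_assoc, swap_swap_mul]

lemma PP_orbit {l : List X} {T : Perm X} (hT : ∀ x ∈ l, T x = x) {a j : X} (ha : a ∈ l)
    (h : SameCycle (l.formPerm * T) a j) : j ∈ l := by
  obtain ⟨i, _, _, hi⟩ := h.exists_pow_eq
  rw [← hi]
  clear hi h
  clear * - hT ha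
  induction i with
  | zero => simpa
  | succ i ih =>
    rw [pow_succ', Perm.mul_apply, Perm.mul_apply, hT _ ih]
    exact List.formPerm_apply_mem_of_mem ih

lemma main_count : ∀ (n : ℕ) (L : List (List X)), 2 * L.flatten.length + L.length ≤ n →
    L.flatten.Nodup → (S (PP L)).card = (L.map (fun l => catalan l.length)).prod := by
  intro n
  induction n with
  | zero =>
    intro L hL _
    have : L = [] := List.eq_nil_of_length_eq_zero (by omega)
    subst this
    have : S (PP ([] : List (List X))) = {1} := by
      ext s
      rw [mem_S, Finset.mem_singleton]
      constructor
      · intro h; apply len_eq_zero; simp [PP, len_one] at h; omega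
      · rintro rfl; simp [PP, len_one]
    rw [this]; simp
  | succ n ih =>
    intro L hL hnd
    match L with
    | [] => exact ih [] (by simp) hnd
    | [] :: L =>
      have := ih L (by simp at hL ⊢; omega) (by simpa using hnd)
      rw [PP_cons]; simpa using this
    | (a :: l) :: L =>
      have hnd1 : (a :: l).Nodup := by
        rw [List.flatten_cons] at hnd; exact hnd.of_append_left
      have hndL : L.flatten.Nodup := by
        rw [List.flatten_cons] at hnd; exact hnd.of_append_right
      have hdis : List.Disjoint (a :: l) L.flatten := by
        rw [List.flatten_cons] at hnd; exact List.disjoint_of_nodup_append hnd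
      have hT : ∀ x ∈ a :: l, PP L x = x := fun x hx => PP_fix (fun h => hdis hx h)
      rw [PP_cons]
      have hcard : (S ((a :: l).formPerm * PP L)).card = ∑ j ∈ (a :: l).toFinset,
          ((S ((a :: l).formPerm * PP L)).filter (fun s => s a = j)).card := by
        apply Finset.card_eq_sum_card_fiberwise
        intro s hs
        have := S_same hs a
        simpa using PP_orbit hT (by simp) this
      rw [hcard, List.sum_toFinset _ hnd1, List.map_cons, List.sum_cons]
      have h0 : ((S ((a :: l).formPerm * PP L)).filter (fun s => s a = a)).card
          = catalan l.length * (L.map (fun l => catalan l.length)).prod := by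
        rw [card_fib (SameCycle.refl _ _)]
        have e : swap a a * ((a :: l).formPerm * PP L) = (a :: l).formPerm * PP L := by
          simp [← Perm.one_def]
        rw [e, PP_R hnd1 (hT a (by simp)), ← PP_cons, ih]
        · simp
        · simp at hL ⊢; omega
        · simp at hnd ⊢; exact hnd.2
      have h1 : ∀ l1 j l2, l = l1 ++ j :: l2 →
          ((S ((a :: l).formPerm * PP L)).filter (fun s => s a = j)).card
          = catalan l1.length * catalan (l2.length + 1)
            * (L.map (fun l => catalan l.length)).prod := by
        intro l1 j l2 hl
        subst hl
        have haj : a ≠ j := by rintro rfl; simp at hnd1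
        have hsc : SameCycle ((a :: (l1 ++ j :: l2)).formPerm * PP L) a j := by
          by_contra hc
          have hlen := len_swap_not hc
          have hd : ∀ l' : List X, (∀ x ∈ l', x ∈ a :: (l1 ++ j :: l2)) →
              Perm.Disjoint l'.formPerm (PP L) := by
            intro l' hl' x
            by_cases hx : x ∈ l'
            · right; exact hT x (hl' x hx)
            · left; exact List.formPerm_apply_of_notMem hx
          have hs2 : SameCycle ((a :: (l1 ++ j :: l2)).formPerm) a j := by
            have := List.pairwise_sameCycle_formPerm hnd1 (by simp; omega)
            rw [List.pairwise_cons] at this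
            exact this.1 j (by simp)
          apply hc
          obtain ⟨i, hi⟩ := hs2
          refine ⟨i, ?_⟩
          rw [(hd _ (fun x hx => hx)).commute.mul_zpow, Perm.mul_apply,
            zpow_apply_eq_self_of_apply_eq_self (hT a (by simp)), hi]
        have hsub : (a :: l1).Nodup := by
          rw [← List.cons_append] at hnd1; exact hnd1.of_append_left
        have haj2 : a ∉ j :: l2 := by
          simp at hnd1 ⊢; tauto
        have e : swap a j * ((a :: (l1 ++ j :: l2)).formPerm * PP L)
            = (a :: l1).formPerm * ((j :: l2).formPerm * PP L) := by
          rw [← mul_assoc, formPerm_split _ _ _ _ hnd1, mul_assoc]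
        rw [card_fib hsc, e, PP_R hsub, ← PP_cons, ← PP_cons, ih]
        · simp [mul_assoc]
        · simp at hL ⊢; omega
        · simp at hnd ⊢; exact hnd.2
        · rw [Perm.mul_apply, hT a (by simp), List.formPerm_apply_of_notMem haj2]
      have h2 : (l.map (fun j => ((S ((a :: l).formPerm * PP L)).filter
          (fun s => s a = j)).card)).sum = ∑ i : Fin l.length,
            catalan i * catalan (l.length - i) * (L.map (fun l => catalan l.length)).prod := by
        rw [← Fin.sum_univ_fun_getElem]
        apply Finset.sum_congr rfl
        intro i _
        rw [h1 (l.take i) _ (l.drop (i + 1)) (by simp)]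
        have := i.2
        simp only [List.length_take, List.length_drop]
        rw [min_eq_left (by omega), show l.length - (i + 1) + 1 = l.length - i by omega]
      rw [h0, h2, List.map_cons, List.prod_cons, List.length_cons, catalan_succ,
        Fin.sum_univ_castSucc, ← Finset.sum_mul]
      simp
      ring

lemma cycleCount_add_len {n : ℕ} (s : Perm (Fin n)) : cycleCount s + len s = n := by
  have h1 := len_add_card s
  have h2 : s.support.card ≤ n := by simpa using Finset.card_le_univ s.support
  unfold cycleCount
  omega

lemma finRotate_list (n : ℕ) (hn : 1 ≤ n) : ∃ l : List (Fin n), l.Nodup ∧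
    l.formPerm = finRotate n ∧ catalan l.length = catalan n ∧ l.length - 1 = n - 1 := by
  rcases Nat.lt_or_ge n 2 with h | h
  · obtain rfl : n = 1 := by omega
    exact ⟨[], by simp, Subsingleton.elim _ _, by simp, by simp⟩
  · obtain ⟨m, rfl⟩ : ∃ m, n = m + 2 := ⟨n - 2, by omega⟩
    have hc := isCycle_finRotate (n := m)
    have h0 : (finRotate (m + 2)) 0 ≠ 0 := by
      rw [← Perm.mem_support, support_finRotate]; simp
    have hl : ((finRotate (m + 2)).toList 0).length = m + 2 := by
      rw [length_toList, hc.cycleOf_eq h0, support_finRotate]; simp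
    refine ⟨(finRotate (m + 2)).toList 0, nodup_toList _ _, ?_, by rw [hl], by rw [hl]⟩
    rw [formPerm_toList, hc.cycleOf_eq h0]

end NCP

theorem noncrossing_card_eq_catalan (α : ℕ) (hα : 1 ≤ α) :
    Fintype.card {σ : Equiv.Perm (Fin α) //
      cycleCount (σ * finRotate α) + cycleCount σ = α + 1} = catalan α := by
  obtain ⟨l, hnd, hl, hcat, hlen⟩ := NCP.finRotate_list α hα
  have hm := NCP.main_count _ [l] le_rfl (by simpa using hnd)
  have hP : NCP.PP [l] = finRotate α := by simp [NCP.PP, hl]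
  have hlr : NCP.len (finRotate α) = α - 1 := by rw [← hl, NCP.len_formPerm hnd, hlen]
  rw [hP] at hm
  rw [← hcat]
  simp only [List.map_cons, List.map_nil, List.prod_cons, List.prod_nil, mul_one] at hm
  rw [← hm, Fintype.card_subtype]
  apply Finset.card_bij (fun s _ => s⁻¹)
  · intro s hs
    rw [Finset.mem_filter] at hs
    rw [NCP.mem_S, NCP.len_inv, inv_inv, hlr]
    have h1 := NCP.cycleCount_add_len s
    have h2 := NCP.cycleCount_add_len (s * finRotate α)
    omega
  · intro s _ s' _ h; exact inv_injective h
  · intro s hs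
    refine ⟨s⁻¹, ?_, inv_inv s⟩
    rw [NCP.mem_S, hlr] at hs
    have h1 := NCP.cycleCount_add_len s⁻¹
    have h2 := NCP.cycleCount_add_len (s⁻¹ * finRotate α)
    rw [NCP.len_inv] at h1
    rw [Finset.mem_filter]
    refine ⟨Finset.mem_univ _, ?_⟩
    omega
end

section
/- For a Haar-random pure state on C^{d_A} ⊗ C^{d_B} and integer α ≥ 1, the expectation of tr(ρ_A^α) equals (1/(α!·D)) · Σ_{σ ∈ S_α} d_A^{ξ(στ)} d_B^{ξ(σ)}, where D = binom(d_A d_B + α − 1, α), τ is the full cycle in S_α, and ξ counts cycles. -/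
open MeasureTheory

/-- Reduced density matrix on the first factor of a bipartite pure state. -/
noncomputable def rhoA {dA dB : ℕ} (ψ : Fin dA × Fin dB → ℂ) : Matrix (Fin dA) (Fin dA) ℂ :=
  Matrix.of fun a a' => ∑ b, ψ (a, b) * star (ψ (a', b))

theorem cycleCount_mul_comm {n : ℕ} (σ τ : Equiv.Perm (Fin n)) :
    cycleCount (σ * τ) = cycleCount (τ * σ) := by
  have h : σ * τ = σ * (τ * σ) * σ⁻¹ := by group
  unfold cycleCount
  rw [h, Equiv.Perm.cycleType_conj, Equiv.Perm.card_support_conj]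

open Classical in
noncomputable def cycKey {n : ℕ} (σ : Equiv.Perm (Fin n)) (x : Fin n) :
    σ.cycleFactorsFinset ⊕ Function.fixedPoints σ :=
  if h : σ x = x then Sum.inr ⟨x, h⟩
  else Sum.inl ⟨σ.cycleOf x, by
    rw [Equiv.Perm.cycleOf_mem_cycleFactorsFinset_iff, Equiv.Perm.mem_support]; exact h⟩

theorem cycKey_surj {n : ℕ} (σ : Equiv.Perm (Fin n)) : Function.Surjective (cycKey σ) := by
  rintro (⟨c, hc⟩ | ⟨x, hx⟩)
  · obtain ⟨x, hx⟩ := (Equiv.Perm.mem_cycleFactorsFinset_iff.mp hc).1.nonempty_support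
    have h := Equiv.Perm.cycle_is_cycleOf hx hc
    have hx' : σ x ≠ x := by
      have := Equiv.Perm.mem_cycleFactorsFinset_support_le hc hx
      simpa using this
    refine ⟨x, ?_⟩
    unfold cycKey
    rw [dif_neg hx']
    simp [h]
  · refine ⟨x, ?_⟩
    have hx' : σ x = x := hx
    unfold cycKey
    exact dif_pos hx'

theorem cycKey_apply {n : ℕ} (σ : Equiv.Perm (Fin n)) (x : Fin n) :
    cycKey σ (σ x) = cycKey σ x := by
  by_cases h : σ x = x
  · rw [h]
  · unfold cycKey
    rw [dif_neg h, dif_neg (by simpa using h)]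
    simp

theorem cycKey_sameCycle {n : ℕ} (σ : Equiv.Perm (Fin n)) (x y : Fin n)
    (h : cycKey σ x = cycKey σ y) : σ.SameCycle x y := by
  unfold cycKey at h
  split_ifs at h with h1 h2 h2
  · have h' : x = y := congrArg Subtype.val (Sum.inr.inj h)
    subst h'; exact Equiv.Perm.SameCycle.refl _ _
  · simp at h
    have : y ∈ (σ.cycleOf x).support := by
      rw [h]; simpa using h2
    exact (Equiv.Perm.mem_support_cycleOf_iff.mp this).1

theorem card_fixed {n : ℕ} {C : Type*} [Fintype C] [DecidableEq C] (σ : Equiv.Perm (Fin n)) :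
    Fintype.card {f : Fin n → C // f ∘ σ = f} = Fintype.card C ^ cycleCount σ := by
  classical
  have key : Function.Bijective
      (fun h : (σ.cycleFactorsFinset ⊕ Function.fixedPoints σ) → C =>
        (⟨h ∘ cycKey σ, by ext x; simp [cycKey_apply]⟩ : {f : Fin n → C // f ∘ σ = f})) := by
    constructor
    · intro h h' e
      simp only [Subtype.mk.injEq] at e
      exact (cycKey_surj σ).injective_comp_right e
    · rintro ⟨f, hf⟩
      refine ⟨f ∘ Function.surjInv (cycKey_surj σ), ?_⟩
      simp only [Subtype.mk.injEq]
      funext x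
      have h1 := cycKey_sameCycle σ _ _ (Function.surjInv_eq (cycKey_surj σ) (cycKey σ x))
      have hpow : ∀ (k : ℕ) y, f ((σ ^ k) y) = f y := by
        intro k
        induction k with
        | zero => simp
        | succ k ih =>
          intro y
          rw [pow_succ', Equiv.Perm.mul_apply, ← ih y]
          exact congrFun hf _
      obtain ⟨k, hk⟩ := h1.exists_nat_pow_eq
      simp only [Function.comp]
      rw [← hpow k, hk]
  rw [← Fintype.card_of_bijective key, Fintype.card_fun, Fintype.card_sum,
    Equiv.Perm.card_fixedPoints]
  congr 1
  unfold cycleCount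
  rw [Equiv.Perm.sum_cycleType, Equiv.Perm.cycleType_def]
  simp

theorem exists_perm_of_map {n : ℕ} {C : Type*} (f f' : Fin n → C)
    (h : Multiset.map f Finset.univ.val = Multiset.map f' Finset.univ.val) :
    ∃ σ : Equiv.Perm (Fin n), f = f' ∘ σ := by
  classical
  have hc : ∀ c : C, Nonempty ({a // f a = c} ≃ {a // f' a = c}) := by
    intro c
    have h2 := congrArg (Multiset.count c) h
    rw [Multiset.count_map, Multiset.count_map] at h2
    rw [← Fintype.card_eq, Fintype.card_subtype, Fintype.card_subtype]
    rw [Finset.card_def, Finset.card_def, Finset.filter_val, Finset.filter_val]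
    simpa only [eq_comm] using h2
  let e : ∀ c : C, {a // f a = c} ≃ {a // f' a = c} := fun c => (hc c).some
  exact ⟨Equiv.ofFiberEquiv e, funext fun a => (Equiv.ofFiberEquiv_map e a).symm⟩

theorem sum_fixed {n : ℕ} {C : Type*} [Fintype C] [DecidableEq C] :
    ∑ σ : Equiv.Perm (Fin n), Fintype.card {f : Fin n → C // f ∘ σ = f}
      = n.factorial * (Fintype.card C + n - 1).choose n := by
  classical
  have : Fintype (Equiv.Perm (Fin n))ᵈᵐᵃ := Fintype.ofEquiv _ DomMulAct.mk
  have hb := MulAction.sum_card_fixedBy_eq_card_orbits_mul_card_group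
    (Equiv.Perm (Fin n))ᵈᵐᵃ (Fin n → C)
  have h1 : ∑ σ : Equiv.Perm (Fin n), Fintype.card {f : Fin n → C // f ∘ σ = f}
    = ∑ a : (Equiv.Perm (Fin n))ᵈᵐᵃ, Fintype.card (MulAction.fixedBy (Fin n → C) a) := by
    refine Fintype.sum_equiv DomMulAct.mk _ _ fun σ => ?_
    refine Fintype.card_congr (Equiv.subtypeEquivRight fun f => ?_)
    rw [MulAction.mem_fixedBy]
    exact Iff.rfl
  rw [h1, hb, mul_comm]
  congr 1
  · rw [← Fintype.card_congr (DomMulAct.mk (M := Equiv.Perm (Fin n))), Fintype.card_perm, Fintype.card_fin]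
  · rw [← Sym.card_sym_eq_choose]
    let g : MulAction.orbitRel.Quotient (Equiv.Perm (Fin n))ᵈᵐᵃ (Fin n → C) → Sym C n :=
      Quotient.lift (fun f => ⟨Finset.univ.val.map f, by simp⟩) (by
        intro f f' h
        obtain ⟨a, ha⟩ := h
        subst ha
        apply Subtype.ext
        let σ : Equiv.Perm (Fin n) := DomMulAct.mk.symm a
        change Multiset.map (f' ∘ σ) Finset.univ.val = Multiset.map f' Finset.univ.val
        rw [← Multiset.map_map, Multiset.map_univ_val_equiv σ])
    refine Fintype.card_of_bijective (f := g) ⟨?_, ?_⟩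
    · intro a b
      refine Quotient.inductionOn₂ a b fun f f' h => ?_
      have h' : Multiset.map f Finset.univ.val = Multiset.map f' Finset.univ.val :=
        congrArg Subtype.val h
      obtain ⟨σ, hσ⟩ := exists_perm_of_map f f' h'
      refine Quotient.sound ⟨DomMulAct.mk σ, ?_⟩
      exact hσ.symm
    · rintro ⟨s, hs⟩
      obtain ⟨l, rfl⟩ := Quot.exists_rep s
      have hl : l.length = n := hs
      subst hl
      refine ⟨Quotient.mk _ l.get, ?_⟩
      apply Subtype.ext
      change Multiset.map l.get Finset.univ.val = (l : Multiset C)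
      simp

theorem trace_pow_succ {ι : Type*} [Fintype ι] [DecidableEq ι] (M : Matrix ι ι ℂ) (n : ℕ) :
    (M ^ n.succ).trace = ∑ p : Fin n.succ → ι, ∏ k, M (p k) (p (finRotate n.succ k)) := by
  have h : ∀ (n : ℕ) (x y : ι), (M ^ n) x y = ∑ p : Fin (n+1) → ι,
      (if p 0 = x then (if p (Fin.last n) = y then
        ∏ k : Fin n, M (p k.castSucc) (p k.succ) else 0) else 0) := by
    intro n
    induction n with
    | zero =>
      intro x y
      rw [← (Equiv.funUnique (Fin 1) ι).symm.sum_comp]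
      simp [Matrix.one_apply]
    | succ n ih =>
      intro x y
      rw [pow_succ, Matrix.mul_apply]
      rw [← (Fin.snocEquiv (fun _ : Fin (n+2) => ι)).sum_comp, Fintype.sum_prod_type_right]
      simp_rw [ih, Finset.sum_mul]
      rw [Finset.sum_comm]
      refine Finset.sum_congr rfl fun p _ => ?_
      have h0 : ∀ z : ι, (Fin.snoc p z : Fin (n+2) → ι) 0 = p 0 := fun z => by
        simp
      simp only [Fin.snocEquiv, Equiv.coe_fn_mk, h0, Fin.snoc_last]
      by_cases hx : p 0 = x
      · simp only [hx, if_true, ite_mul, zero_mul, Finset.sum_ite_eq, Finset.mem_univ]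
        rw [Finset.sum_ite_eq' ]
        simp only [Finset.mem_univ, if_true]
        rw [Fin.prod_univ_castSucc]
        congr 1
        · refine Finset.prod_congr rfl fun k _ => ?_
          rw [Fin.snoc_castSucc, ← Fin.castSucc_succ, Fin.snoc_castSucc]
        · simp
      · simp [hx]
  rw [pow_succ, Matrix.trace]
  simp only [Matrix.diag_apply, Matrix.mul_apply, h, Finset.sum_mul]
  rw [Finset.sum_congr rfl fun x _ => Finset.sum_comm]
  rw [Finset.sum_comm]
  refine Finset.sum_congr rfl fun p _ => ?_
  rw [Finset.sum_eq_single (p 0), Finset.sum_eq_single (p (Fin.last n))]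
  · simp only [if_true]
    rw [Fin.prod_univ_castSucc]
    congr 1
    · refine Finset.prod_congr rfl fun k _ => ?_
      simp
    · simp
  · intro y _ hy; simp [hy.symm]
  · simp
  · intro y _ hy; simp [hy.symm]
  · simp

theorem ryser {n : ℕ} (A : Fin n → Fin n → ℂ) :
    ∑ T : Finset (Fin n), (-1 : ℂ) ^ (n - T.card) * ∏ k, ∑ l ∈ T, A k l
      = ∑ σ : Equiv.Perm (Fin n), ∏ k, A k (σ k) := by
  classical
  have h1 : ∀ T : Finset (Fin n), ∏ k, ∑ l ∈ T, A k l
      = ∑ f : Fin n → Fin n, if Finset.univ.image f ⊆ T then ∏ k, A k (f k) else 0 := by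
    intro T
    rw [Finset.prod_univ_sum, ← Finset.sum_filter]
    refine Finset.sum_congr ?_ fun _ _ => rfl
    ext f
    simp [Fintype.mem_piFinset, Finset.image_subset_iff]
  simp_rw [h1, Finset.mul_sum]
  rw [Finset.sum_comm]
  have h2 : ∀ f : Fin n → Fin n, ∑ T : Finset (Fin n), (-1 : ℂ) ^ (n - T.card) *
      (if Finset.univ.image f ⊆ T then ∏ k, A k (f k) else 0)
      = if Function.Bijective f then ∏ k, A k (f k) else 0 := by
    intro f
    have h3 : ∑ T : Finset (Fin n), (-1 : ℂ) ^ (n - T.card) *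
      (if Finset.univ.image f ⊆ T then ∏ k, A k (f k) else 0)
      = ∑ S ∈ ((Finset.univ.image f)ᶜ).powerset, ((((-1 : ℤ) ^ S.card : ℤ)) : ℂ) * ∏ k, A k (f k) := by
      simp only [mul_ite, mul_zero]
      rw [← Finset.sum_filter]
      refine Finset.sum_bij' (fun T _ => Tᶜ) (fun S _ => Sᶜ) ?_ ?_ ?_ ?_ ?_
      · intro T hT; simpa using hT
      · intro S hS
        simp only [Finset.mem_powerset] at hS
        simp only [Finset.mem_filter, Finset.mem_univ, true_and]
        exact Finset.subset_compl_comm.mp hS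
      · simp
      · simp
      · intro T _
        simp [Finset.card_compl]
    rw [h3, ← Finset.sum_mul, ← Int.cast_sum, Finset.sum_powerset_neg_one_pow_card]
    have : (Finset.univ.image f)ᶜ = ∅ ↔ Function.Bijective f := by
      rw [Finset.compl_eq_empty_iff, ← Finite.surjective_iff_bijective, Finset.eq_univ_iff_forall]
      simp [Function.Surjective]
    by_cases hf : Function.Bijective f <;> simp [this]
  simp_rw [h2]
  rw [← Finset.sum_filter]
  symm
  refine Finset.sum_bij (fun σ _ => ⇑σ) ?_ ?_ ?_ ?_
  · intro σ _; exact Finset.mem_filter.mpr ⟨Finset.mem_univ _, σ.bijective⟩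
  · intro a _ b _ h; exact DFunLike.coe_injective h
  · intro f hf
    exact ⟨Equiv.ofBijective f ((Finset.mem_filter.mp hf).2), Finset.mem_univ _, rfl⟩
  · intros; rfl

theorem cont_integrable {X : Type*} [Fintype X] (μ : Measure (X → ℂ)) [IsProbabilityMeasure μ]
    (hsupp : ∀ᵐ ψ ∂μ, ∑ x, Complex.normSq (ψ x) = 1) (F : (X → ℂ) → ℂ) (hF : Continuous F) :
    Integrable F μ := by
  have hcl : IsClosed {ψ : X → ℂ | ∑ x, Complex.normSq (ψ x) = 1} :=
    isClosed_eq (by fun_prop) continuous_const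
  have hbd : Bornology.IsBounded {ψ : X → ℂ | ∑ x, Complex.normSq (ψ x) = 1} := by
    refine (Metric.isBounded_closedBall (x := (0 : X → ℂ)) (r := 1)).subset ?_
    intro ψ hψ
    rw [mem_closedBall_zero_iff, pi_norm_le_iff_of_nonneg zero_le_one]
    intro x
    have h1 : Complex.normSq (ψ x) ≤ 1 := by
      rw [← (show ∑ x, Complex.normSq (ψ x) = 1 from hψ)]
      exact Finset.single_le_sum (f := fun x => Complex.normSq (ψ x))
        (fun i _ => Complex.normSq_nonneg _) (Finset.mem_univ x)
    rw [Complex.normSq_eq_norm_sq] at h1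
    nlinarith [norm_nonneg (ψ x)]
  have hc := Metric.isCompact_of_isClosed_isBounded hcl hbd
  obtain ⟨C, hC⟩ := hc.exists_bound_of_continuousOn hF.continuousOn
  refine Integrable.of_bound hF.aestronglyMeasurable C ?_
  filter_upwards [hsupp] with ψ hψ using hC ψ hψ

theorem inv_integral {X : Type*} [Fintype X] [DecidableEq X] (μ : Measure (X → ℂ))
    (hinv : ∀ U ∈ Matrix.unitaryGroup X ℂ, Measure.map (fun ψ => U.mulVec ψ) μ = μ)
    (U : Matrix X X ℂ) (hU : U ∈ Matrix.unitaryGroup X ℂ)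
    (F : (X → ℂ) → ℂ) (hF : Continuous F) :
    ∫ ψ, F (U.mulVec ψ) ∂μ = ∫ ψ, F ψ ∂μ := by
  have hm : Continuous fun ψ : X → ℂ => U.mulVec ψ := by fun_prop
  conv_rhs => rw [← hinv U hU]
  rw [integral_map hm.measurable.aemeasurable hF.aestronglyMeasurable]

theorem circle_infinite : Set.Infinite {z : ℂ | star z * z = 1} := by
  refine Set.infinite_of_injOn_mapsTo (s := Set.Icc (0:ℝ) 1)
    (f := fun t => (⟨t, Real.sqrt (1 - t^2)⟩ : ℂ)) ?_ ?_ (Set.Icc_infinite zero_lt_one)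
  · intro a _ b _ h
    exact congrArg Complex.re h
  · intro t ht
    have h : Real.sqrt (1 - t^2) * Real.sqrt (1 - t^2) = 1 - t^2 :=
      Real.mul_self_sqrt (by nlinarith [ht.1, ht.2])
    simp only [Set.mem_ofPred_eq]
    apply Complex.ext
    · simp; rw [h]; ring
    · simp; ring

theorem first_moment_aux {X : Type*} [Fintype X] [DecidableEq X] (μ : Measure (X → ℂ))
    [IsProbabilityMeasure μ]
    (hsupp : ∀ᵐ ψ ∂μ, ∑ x, Complex.normSq (ψ x) = 1)
    (hinv : ∀ U ∈ Matrix.unitaryGroup X ℂ, Measure.map (fun ψ => U.mulVec ψ) μ = μ)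
    (α : ℕ) (x0 : X) (v : X → ℂ) :
    ∫ ψ, ψ x0 ^ α * star (v ⬝ᵥ ψ) ^ α ∂μ
      = star (v x0) ^ α * ∫ ψ, ψ x0 ^ α * star (ψ x0) ^ α ∂μ := by
  set I := ∫ ψ, ψ x0 ^ α * star (v ⬝ᵥ ψ) ^ α ∂μ with hI
  let R : (X → ℂ) → ℂ := fun ψ => star (∑ x ∈ Finset.univ.erase x0, v x * ψ x)
  have hR : Continuous R := by fun_prop
  let c : ℕ → ℂ := fun k => ∫ ψ, ψ x0 ^ α * (R ψ ^ k * star (v x0 * ψ x0) ^ (α - k) * (α.choose k : ℂ)) ∂μ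
  let P : Polynomial ℂ := ∑ k ∈ Finset.range (α + 1), Polynomial.C (c k) * Polynomial.X ^ k
  have hP : ∀ z : ℂ, star z * z = 1 → P.eval z = I := by
    intro z hz
    have hz' : z * star z = 1 := by rw [mul_comm]; exact hz
    let d : X → ℂ := fun x => if x = x0 then 1 else star z
    have hU : Matrix.diagonal d ∈ Matrix.unitaryGroup X ℂ := by
      rw [Matrix.mem_unitaryGroup_iff, Matrix.star_eq_conjTranspose, Matrix.diagonal_conjTranspose,
        Matrix.diagonal_mul_diagonal, ← Matrix.diagonal_one]
      congr 1
      funext x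
      by_cases h : x = x0
      · simp [d, h]
      · simp only [d, h, if_false, Pi.star_apply, star_star]; exact hz
    have h1 := inv_integral μ hinv _ hU (fun ψ => ψ x0 ^ α * star (v ⬝ᵥ ψ) ^ α) (by
      unfold dotProduct; fun_prop)
    rw [hI, ← h1]
    have h2 : ∀ ψ : X → ℂ, (fun ψ : X → ℂ => ψ x0 ^ α * star (v ⬝ᵥ ψ) ^ α)
        ((Matrix.diagonal d).mulVec ψ) = ∑ k ∈ Finset.range (α+1),
          (ψ x0 ^ α * (R ψ ^ k * star (v x0 * ψ x0) ^ (α - k) * (α.choose k : ℂ))) * z ^ k := by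
      intro ψ
      have e1 : star (v ⬝ᵥ (Matrix.diagonal d).mulVec ψ) = z * R ψ + star (v x0 * ψ x0) := by
        simp only [dotProduct, Matrix.mulVec_diagonal]
        rw [← Finset.sum_erase_add _ _ (Finset.mem_univ x0), star_add]
        congr 1
        · simp only [R]
          rw [← star_star z, ← star_mul', Finset.mul_sum]
          congr 1
          refine Finset.sum_congr rfl fun x hx => ?_
          simp only [d, Finset.ne_of_mem_erase hx, if_false]; ring
        · simp [d]
      simp only
      rw [e1, add_pow, Finset.mul_sum, Matrix.mulVec_diagonal]
      refine Finset.sum_congr rfl fun k _ => ?_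
      simp only [d, if_true, one_mul]
      ring
    simp_rw [h2]
    rw [integral_finsetSum]
    · simp only [P, Polynomial.eval_finsetSum, Polynomial.eval_mul, Polynomial.eval_C,
        Polynomial.eval_pow, Polynomial.eval_X]
      refine Finset.sum_congr rfl fun k _ => ?_
      rw [integral_mul_const]
    · intro k _
      exact cont_integrable μ hsupp _ (by fun_prop)
  have hPC : P = Polynomial.C I := by
    apply Polynomial.eq_of_infinite_eval_eq
    refine circle_infinite.mono ?_
    intro z hz
    simp only [Set.mem_ofPred_eq, Polynomial.eval_C]
    exact hP z hz
  have h0 : P.eval 0 = c 0 := by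
    simp only [P, Polynomial.eval_finsetSum, Polynomial.eval_mul, Polynomial.eval_C,
        Polynomial.eval_pow, Polynomial.eval_X]
    rw [Finset.sum_eq_single 0]
    · simp
    · intro k _ hk; simp [hk]
    · simp
  rw [hPC, Polynomial.eval_C] at h0
  rw [h0]
  simp only [c]
  rw [← integral_const_mul]
  congr 1
  funext ψ
  simp only [star_mul', pow_zero, Nat.sub_zero, Nat.choose_zero_right, Nat.cast_one, mul_pow]
  ring

theorem exists_unitary {X : Type*} [Fintype X] [DecidableEq X] (x0 : X) (u : X → ℂ) (hu : u ≠ 0) :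
    ∃ U ∈ Matrix.unitaryGroup X ℂ, ∃ r : ℝ, r ≠ 0 ∧ ∀ y, (r : ℂ) * U x0 y = u y := by
  let w : EuclideanSpace ℂ X := WithLp.toLp 2 u
  have hw : w ≠ 0 := by
    intro h; apply hu
    funext x
    exact congrFun (congrArg (WithLp.ofLp) h) x
  have hn : ‖w‖ ≠ 0 := norm_ne_zero_iff.mpr hw
  have ho : Orthonormal ℂ (({x0} : Set X).domRestrict (fun _ => ((‖w‖⁻¹ : ℝ) : ℂ) • w)) := by
    constructor
    · rintro ⟨i, hi⟩
      simp [Set.domRestrict, norm_smul, hn]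
    · rintro ⟨i, hi⟩ ⟨j, hj⟩ hij
      exact absurd (Subtype.ext ((Set.mem_singleton_iff.mp hi).trans (Set.mem_singleton_iff.mp hj).symm)) hij
  obtain ⟨b, hb⟩ := ho.exists_orthonormalBasis_extension_of_card_eq (by simp)
  refine ⟨Matrix.of fun x y => b x y, ?_, ‖w‖, hn, ?_⟩
  · rw [Matrix.mem_unitaryGroup_iff]
    ext x y
    have := orthonormal_iff_ite.mp b.orthonormal y x
    rw [PiLp.inner_apply] at this
    simp only [Matrix.mul_apply, Matrix.of_apply, Matrix.star_apply, Matrix.one_apply]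
    simp only [RCLike.inner_apply] at this
    simp only [eq_comm (a := x)]
    exact this
  · intro y
    simp only [Matrix.of_apply]
    rw [hb x0 rfl]
    have : (‖w‖ : ℂ) ≠ 0 := by exact_mod_cast hn
    have h2 : (((‖w‖⁻¹ : ℝ) : ℂ) • w) y = (‖w‖ : ℂ)⁻¹ * u y := by simp [w]
    rw [h2, mul_inv_cancel_left₀ this]

theorem second_moment {X : Type*} [Fintype X] [DecidableEq X] (μ : Measure (X → ℂ))
    [IsProbabilityMeasure μ]
    (hsupp : ∀ᵐ ψ ∂μ, ∑ x, Complex.normSq (ψ x) = 1)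
    (hinv : ∀ U ∈ Matrix.unitaryGroup X ℂ, Measure.map (fun ψ => U.mulVec ψ) μ = μ)
    (α : ℕ) (hα : 1 ≤ α) (x0 : X) (u v : X → ℂ) :
    ∫ ψ, (u ⬝ᵥ ψ) ^ α * star (v ⬝ᵥ ψ) ^ α ∂μ
      = (∑ x, u x * star (v x)) ^ α * ∫ ψ, ψ x0 ^ α * star (ψ x0) ^ α ∂μ := by
  by_cases hu : u = 0
  · subst hu
    have : α ≠ 0 := by omega
    simp [this]
  obtain ⟨U, hU, r, hr, hrow⟩ := exists_unitary x0 u hu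
  let v' : X → ℂ := Matrix.vecMul v (star U)
  have h1 := inv_integral μ hinv U hU
    (fun ψ => (r * ψ x0) ^ α * star (v' ⬝ᵥ ψ) ^ α) (by unfold dotProduct; fun_prop)
  have h2 : ∀ ψ : X → ℂ, (u ⬝ᵥ ψ) ^ α * star (v ⬝ᵥ ψ) ^ α =
      (fun ψ : X → ℂ => (r * ψ x0) ^ α * star (v' ⬝ᵥ ψ) ^ α) (U.mulVec ψ) := by
    intro ψ
    simp only [v']
    rw [Matrix.dotProduct_mulVec, Matrix.vecMul_vecMul, Matrix.mem_unitaryGroup_iff'.mp hU,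
      Matrix.vecMul_one]
    congr 2
    simp only [Matrix.mulVec, dotProduct, Finset.mul_sum]
    refine Finset.sum_congr rfl fun y _ => ?_
    rw [← hrow]; ring
  simp_rw [h2]
  rw [h1]
  have h3 : ∀ ψ : X → ℂ, (r * ψ x0) ^ α * star (v' ⬝ᵥ ψ) ^ α =
    (r : ℂ) ^ α * (ψ x0 ^ α * star (v' ⬝ᵥ ψ) ^ α) := by intro ψ; ring
  simp_rw [h3]
  rw [integral_const_mul, first_moment_aux μ hsupp hinv, ← mul_assoc, ← mul_pow]
  congr 2
  simp only [v', Matrix.vecMul, dotProduct, star_sum, Finset.mul_sum]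
  refine Finset.sum_congr rfl fun y _ => ?_
  rw [← hrow]
  simp only [Matrix.star_apply, star_mul', star_star]
  ring

theorem polar {n : ℕ} (z : Fin n → ℂ) :
    ∑ T : Finset (Fin n), (-1 : ℂ) ^ (n - T.card) * (∑ l ∈ T, z l) ^ n
      = n.factorial * ∏ k, z k := by
  have h := ryser (fun _ l : Fin n => z l)
  simp only [Finset.prod_const, Finset.card_univ, Fintype.card_fin] at h
  rw [h, Finset.sum_congr rfl fun σ _ => Equiv.prod_comp σ z]
  simp [Fintype.card_perm]

theorem moment {X : Type*} [Fintype X] [DecidableEq X] (μ : Measure (X → ℂ))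
    [IsProbabilityMeasure μ]
    (hsupp : ∀ᵐ ψ ∂μ, ∑ x, Complex.normSq (ψ x) = 1)
    (hinv : ∀ U ∈ Matrix.unitaryGroup X ℂ, Measure.map (fun ψ => U.mulVec ψ) μ = μ)
    (α : ℕ) (hα : 1 ≤ α) (x0 : X) (i j : Fin α → X) :
    (α.factorial : ℂ) * ∫ ψ, (∏ k, ψ (i k)) * ∏ k, star (ψ (j k)) ∂μ
      = (∫ ψ, ψ x0 ^ α * star (ψ x0) ^ α ∂μ) *
        ∑ σ : Equiv.Perm (Fin α), ∏ k, if i k = j (σ k) then (1 : ℂ) else 0 := by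
  have hf : (α.factorial : ℂ) ≠ 0 := by exact_mod_cast α.factorial_ne_zero
  apply mul_left_cancel₀ hf
  let u : Finset (Fin α) → X → ℂ := fun S x => ∑ l ∈ S, if i l = x then 1 else 0
  let v : Finset (Fin α) → X → ℂ := fun S x => ∑ l ∈ S, if j l = x then 1 else 0
  have hu : ∀ S (ψ : X → ℂ), ∑ l ∈ S, ψ (i l) = u S ⬝ᵥ ψ := by
    intro S ψ
    simp only [u, dotProduct, Finset.sum_mul]
    rw [Finset.sum_comm]
    simp
  have hv : ∀ S (ψ : X → ℂ), ∑ l ∈ S, star (ψ (j l)) = star (v S ⬝ᵥ ψ) := by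
    intro S ψ
    simp only [v, dotProduct, Finset.sum_mul]
    rw [Finset.sum_comm]
    simp
  have huv : ∀ S T, ∑ x, u S x * star (v T x) = ∑ k ∈ S, ∑ l ∈ T, if i k = j l then (1 : ℂ) else 0 := by
    intro S T
    simp only [u, Finset.sum_mul]
    rw [Finset.sum_comm]
    refine Finset.sum_congr rfl fun k _ => ?_
    simp [v, eq_comm]
  have e1 : ∀ ψ : X → ℂ, (α.factorial : ℂ) * (α.factorial * ((∏ k, ψ (i k)) * ∏ k, star (ψ (j k))))
      = ∑ T : Finset (Fin α), ∑ S : Finset (Fin α), ((-1 : ℂ) ^ (α - T.card) * (-1 : ℂ) ^ (α - S.card)) *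
        ((u S ⬝ᵥ ψ) ^ α * star (v T ⬝ᵥ ψ) ^ α) := by
    intro ψ
    have a1 := polar (fun k => ψ (i k))
    have a2 := polar (fun k => star (ψ (j k)))
    calc _ = ((α.factorial : ℂ) * ∏ k, star (ψ (j k))) * (α.factorial * ∏ k, ψ (i k)) := by ring
      _ = _ := by
        rw [← a1, ← a2, Finset.sum_mul_sum]
        refine Finset.sum_congr rfl fun T _ => Finset.sum_congr rfl fun S _ => ?_
        rw [hu, hv]; ring
  rw [← integral_const_mul, ← integral_const_mul]
  simp_rw [e1]
  have hint : ∀ S T, Integrable (fun ψ : X → ℂ => ((-1 : ℂ) ^ (α - T.card) * (-1 : ℂ) ^ (α - S.card)) *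
        ((u S ⬝ᵥ ψ) ^ α * star (v T ⬝ᵥ ψ) ^ α)) μ := fun S T =>
    cont_integrable μ hsupp _ (by unfold dotProduct; fun_prop)
  rw [integral_finsetSum _ fun T _ => integrable_finsetSum _ fun S _ => hint S T]
  simp_rw [integral_finsetSum _ fun S _ => hint S _, integral_const_mul,
    second_moment μ hsupp hinv α hα x0, huv]
  set c := ∫ ψ, ψ x0 ^ α * star (ψ x0) ^ α ∂μ
  rw [← ryser (fun k l => if i k = j l then (1 : ℂ) else 0)]
  rw [Finset.mul_sum, Finset.mul_sum]
  refine Finset.sum_congr rfl fun T _ => ?_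
  have a3 := polar (fun k => ∑ l ∈ T, if i k = j l then (1 : ℂ) else 0)
  calc _ = ((-1 : ℂ) ^ (α - T.card) * c) * ∑ S : Finset (Fin α), (-1 : ℂ) ^ (α - S.card) *
        (∑ k ∈ S, ∑ l ∈ T, if i k = j l then (1 : ℂ) else 0) ^ α := by
        rw [Finset.mul_sum]
        refine Finset.sum_congr rfl fun S _ => ?_
        ring
    _ = _ := by rw [a3]; ring

theorem sum_delta {n : ℕ} {C : Type*} [Fintype C] [DecidableEq C] (σ : Equiv.Perm (Fin n)) :
    ∑ f : Fin n → C, (∏ k, if f k = f (σ k) then (1 : ℂ) else 0)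
      = (Fintype.card C : ℂ) ^ cycleCount σ := by
  have h : ∀ f : Fin n → C, (∏ k, if f k = f (σ k) then (1 : ℂ) else 0)
      = if f ∘ σ = f then 1 else 0 := by
    intro f
    rw [Fintype.prod_ite_zero]
    simp only [Finset.prod_const_one, funext_iff, Function.comp]
    simp only [eq_comm]
  simp_rw [h]
  rw [Finset.sum_boole, ← Nat.cast_pow, ← card_fixed, Fintype.card_subtype]

theorem const_value {X : Type*} [Fintype X] [DecidableEq X] (μ : Measure (X → ℂ))
    [IsProbabilityMeasure μ]
    (hsupp : ∀ᵐ ψ ∂μ, ∑ x, Complex.normSq (ψ x) = 1)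
    (hinv : ∀ U ∈ Matrix.unitaryGroup X ℂ, Measure.map (fun ψ => U.mulVec ψ) μ = μ)
    (α : ℕ) (hα : 1 ≤ α) (x0 : X) :
    (∫ ψ, ψ x0 ^ α * star (ψ x0) ^ α ∂μ) * ((Fintype.card X + α - 1).choose α : ℂ) = 1 := by
  have hf : (α.factorial : ℂ) ≠ 0 := by exact_mod_cast α.factorial_ne_zero
  have h1 : ∑ i : Fin α → X, ∫ ψ, (∏ k, ψ (i k)) * ∏ k, star (ψ (i k)) ∂μ = 1 := by
    rw [← integral_finsetSum _ fun i _ => cont_integrable μ hsupp _ (by fun_prop)]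
    have h2 : ∀ᵐ ψ ∂μ, ∑ i : Fin α → X, (∏ k, ψ (i k)) * ∏ k, star (ψ (i k)) = 1 := by
      filter_upwards [hsupp] with ψ hψ
      simp_rw [← Finset.prod_mul_distrib]
      have h5 := Finset.prod_univ_sum (fun _ : Fin α => (Finset.univ : Finset X))
        (fun _ x => ψ x * star (ψ x))
      rw [Fintype.piFinset_univ] at h5
      rw [← h5]
      have : ∑ x, ψ x * star (ψ x) = 1 := by
        have h3 := congrArg (fun t : ℝ => (t : ℂ)) hψ
        simp only [Complex.ofReal_sum, Complex.ofReal_one] at h3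
        rw [← h3]
        exact Finset.sum_congr rfl fun x _ => Complex.mul_conj _
      simp_rw [this]
      simp
    rw [integral_congr_ae h2]
    simp
  have h3 := congrArg (fun t => (α.factorial : ℂ) * t) h1
  simp only [Finset.mul_sum, moment μ hsupp hinv α hα x0] at h3
  rw [Finset.sum_comm] at h3
  simp_rw [← Finset.mul_sum, sum_delta] at h3
  have h4 := congrArg (fun t : ℕ => (t : ℂ)) (sum_fixed (n := α) (C := X))
  simp only [card_fixed] at h4
  push_cast at h4
  rw [h4] at h3
  apply mul_left_cancel₀ hf
  rw [← h3]; ring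

theorem haar_average_trace_power (dA dB : ℕ) (hA : 0 < dA) (hB : 0 < dB)
    (α : ℕ) (hα : 1 ≤ α)
    (μ : Measure ((Fin dA × Fin dB) → ℂ)) [IsProbabilityMeasure μ]
    (hsupp : ∀ᵐ ψ ∂μ, ∑ x, Complex.normSq (ψ x) = 1)
    (hinv : ∀ U ∈ Matrix.unitaryGroup (Fin dA × Fin dB) ℂ,
      Measure.map (fun ψ => U.mulVec ψ) μ = μ) :
    ∫ ψ, (((rhoA ψ) ^ α).trace).re ∂μ
      = (1 / ((α.factorial : ℝ) * (Nat.choose (dA * dB + α - 1) α : ℝ))) *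
          ∑ σ : Equiv.Perm (Fin α),
            (dA : ℝ) ^ cycleCount (σ * finRotate α) * (dB : ℝ) ^ cycleCount σ := by
  have hf : (α.factorial : ℂ) ≠ 0 := by exact_mod_cast α.factorial_ne_zero
  let x0 : Fin dA × Fin dB := (⟨0, hA⟩, ⟨0, hB⟩)
  have htr : ∀ ψ : Fin dA × Fin dB → ℂ, ((rhoA ψ) ^ α).trace
      = ∑ a : Fin α → Fin dA, ∑ b : Fin α → Fin dB,
        (∏ k, ψ (a k, b k)) * ∏ k, star (ψ (a (finRotate α k), b k)) := by
    intro ψ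
    obtain ⟨n, rfl⟩ : ∃ n, α = n.succ := ⟨α - 1, by omega⟩
    rw [trace_pow_succ]
    refine Finset.sum_congr rfl fun a _ => ?_
    simp only [rhoA, Matrix.of_apply]
    rw [Finset.prod_univ_sum, Fintype.piFinset_univ]
    simp_rw [Finset.prod_mul_distrib]
  have hcomp : ∫ ψ, ((rhoA ψ) ^ α).trace ∂μ
      = (1 / ((α.factorial : ℂ) * (Nat.choose (dA * dB + α - 1) α : ℂ))) *
          ∑ σ : Equiv.Perm (Fin α),
            (dA : ℂ) ^ cycleCount (σ * finRotate α) * (dB : ℂ) ^ cycleCount σ := by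
    simp_rw [htr]
    rw [integral_finsetSum _ fun a _ => cont_integrable μ hsupp _ (by fun_prop)]
    have hsw : ∀ a : Fin α → Fin dA, ∫ ψ, ∑ b : Fin α → Fin dB,
        (∏ k, ψ (a k, b k)) * ∏ k, star (ψ (a (finRotate α k), b k)) ∂μ
        = ∑ b : Fin α → Fin dB, ∫ ψ,
        (∏ k, ψ (a k, b k)) * ∏ k, star (ψ (a (finRotate α k), b k)) ∂μ := fun a =>
      integral_finsetSum _ fun b _ => cont_integrable μ hsupp _ (by fun_prop)
    simp_rw [hsw]
    have hm : ∀ (a : Fin α → Fin dA) (b : Fin α → Fin dB),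
        ∫ ψ, (∏ k, ψ (a k, b k)) * ∏ k, star (ψ (a (finRotate α k), b k)) ∂μ
        = (1 / (α.factorial : ℂ)) * ((∫ ψ, ψ x0 ^ α * star (ψ x0) ^ α ∂μ) *
          ∑ σ : Equiv.Perm (Fin α), (∏ k, if a k = a ((finRotate α * σ) k) then (1 : ℂ) else 0) *
            ∏ k, if b k = b (σ k) then (1 : ℂ) else 0) := by
      intro a b
      have := moment μ hsupp hinv α hα x0 (fun k => (a k, b k)) (fun k => (a (finRotate α k), b k))
      have h2 : ∀ σ : Equiv.Perm (Fin α),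
        (∏ k, if ((a k, b k) : Fin dA × Fin dB) = (a (finRotate α (σ k)), b (σ k)) then (1 : ℂ) else 0)
        = (∏ k, if a k = a ((finRotate α * σ) k) then (1 : ℂ) else 0) *
            ∏ k, if b k = b (σ k) then (1 : ℂ) else 0 := by
        intro σ
        rw [← Finset.prod_mul_distrib]
        refine Finset.prod_congr rfl fun k _ => ?_
        simp only [Prod.mk.injEq, Equiv.Perm.mul_apply]
        split_ifs <;> simp_all
      simp_rw [h2] at this
      rw [← this]
      field_simp
    simp_rw [hm, ← Finset.mul_sum]
    have hc := const_value μ hsupp hinv α hα x0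
    rw [Fintype.card_prod, Fintype.card_fin, Fintype.card_fin] at hc
    rw [← eq_one_div_of_mul_eq_one_left hc |>.symm, ← mul_assoc, one_div_mul_one_div]
    congr 1
    rw [Finset.sum_congr rfl fun a _ => Finset.sum_comm, Finset.sum_comm]
    refine Finset.sum_congr rfl fun σ _ => ?_
    simp_rw [← Finset.mul_sum, ← Finset.sum_mul, sum_delta]
    rw [cycleCount_mul_comm]
    simp
  have hre : ∫ ψ, (((rhoA ψ) ^ α).trace).re ∂μ = (∫ ψ, ((rhoA ψ) ^ α).trace ∂μ).re := by
    refine integral_re (𝕜 := ℂ) ?_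
    refine cont_integrable μ hsupp _ ?_
    simp_rw [htr]
    fun_prop
  rw [hre, hcomp]
  rw [← Complex.ofReal_re ((1 / ((α.factorial : ℝ) * (Nat.choose (dA * dB + α - 1) α : ℝ))) * _)]
  congr 1
  push_cast
  rfl
end
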